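/- Let α > 0 and let f ∈ E(K̄). For every t > 0 the function x ↦ u(x,t) = ∫_{K̄} f(x + y) π(t, dy) belongs to E(K̄), and for every x ∈ S = {x ∈ K̄ : ‖T_n(x)‖ ≤ q_n^{d_n/m_n}·‖m_n‖ for all n ≥ 1} the map t ↦ u(x,t) is differentiable on (0,∞) with ∂u/∂t(x,t) + (D^α u(·,t))(x) = 0; moreover u(x,t) → f(x) as t → 0 for x ∈ S. In this sense −D^α is the generator of the semigroup of the measures π(t,·). -/

import Mathlib

open MeasureTheory Module
open scoped Classical

noncomputable section

/-- The topology defined by a translation-invariant "norm" function via open balls. -/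
def normTopology {X : Type} [Sub X] (f : X → ℝ) : TopologicalSpace X :=
  TopologicalSpace.generateFrom
    {U | ∃ x : X, ∃ ε : ℝ, 0 < ε ∧ U = {y : X | f (y - x) < ε}}

variable (p : ℕ) [Fact (Nat.Prime p)]
variable (k : Type) [Field k] [Algebra ℚ_[p] k] [FiniteDimensional ℚ_[p] k]

/-- The normalized absolute value on the local field k. -/
def absk (x : k) : ℝ := ‖(Algebra.norm ℚ_[p] x : ℚ_[p])‖

/-- The topology of k as a local field. -/
def kTop : TopologicalSpace k := normTopology (absk p k)

variable (K : Type) [Field K] [Algebra k K] [CharZero K]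
variable (Kn : ℕ → IntermediateField k K)

/-- The relative trace map between two intermediate fields. -/
def relTrace (E F : IntermediateField k K) (h : E ≤ F) (x : F) : E :=
  (@Algebra.trace E F _ _ (IntermediateField.inclusion h).toRingHom.toAlgebra) x

variable (T : ℕ → K →ₗ[k] K)

/-- The projective limit K̄ of the fields Kₙ along the normalized trace maps. -/
def ProjLim : Type :=
  {x : ℕ → K // (∀ n, x n ∈ Kn n) ∧ ∀ ⦃n ν : ℕ⦄, n ≤ ν → T n (x ν) = x n}

/-- Pointwise addition on K̄. -/
def pladd (x y : ProjLim k K Kn T) : ProjLim k K Kn T :=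
  ⟨fun n => x.1 n + y.1 n, by
    refine ⟨fun n => add_mem (x.2.1 n) (y.2.1 n), ?_⟩
    intro n ν h
    simp [map_add, x.2.2 h, y.2.2 h]⟩

/-- Pointwise scalar multiplication on K̄. -/
def plsmul (c : k) (x : ProjLim k K Kn T) : ProjLim k K Kn T :=
  ⟨fun n => c • x.1 n, by
    refine ⟨fun n => (Kn n).toSubalgebra.smul_mem (x.2.1 n) c, ?_⟩
    intro n ν h
    simp [_root_.map_smul, x.2.2 h]⟩

/-- The topology on K̄ given by the seminorms x ↦ ‖xₙ‖. -/
def projTop (Knorm : K → ℝ) : TopologicalSpace (ProjLim k K Kn T) :=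
  TopologicalSpace.generateFrom
    {U | ∃ x : ProjLim k K Kn T, ∃ n : ℕ, ∃ ε : ℝ, 0 < ε ∧
          U = {y : ProjLim k K Kn T | Knorm (y.1 n - x.1 n) < ε}}

/-- The Borel σ-algebra of the seminorm topology on K̄. -/
def projMeas (Knorm : K → ℝ) : MeasurableSpace (ProjLim k K Kn T) :=
  @borel _ (projTop k K Kn T Knorm)

/-- The topology on Kₙ induced from the absolute value ‖·‖. -/
def KnTop (Knorm : K → ℝ) (n : ℕ) : TopologicalSpace (Kn n) :=
  TopologicalSpace.induced Subtype.val (normTopology Knorm)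

/-- The Borel σ-algebra of Kₙ. -/
def KnMeas (Knorm : K → ℝ) (n : ℕ) : MeasurableSpace (Kn n) :=
  @borel _ (KnTop k K Kn Knorm n)

/-- The canonical embedding of K into K̄. -/
def emb (hTmem : ∀ n x, T n x ∈ Kn n)
    (hTproj : ∀ ⦃n ν : ℕ⦄, n ≤ ν → ∀ x : K, T n (T ν x) = T n x) (x : K) :
    ProjLim k K Kn T :=
  ⟨fun n => T n x, fun n => hTmem n x, fun n ν h => hTproj h x⟩

/-- The weak topology σ(K̄, K) on K̄. -/
def weakTop (pairing : K → ProjLim k K Kn T → k) : TopologicalSpace (ProjLim k K Kn T) :=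
  ⨅ a : K, TopologicalSpace.induced (pairing a) (kTop p k)

/-- Non-archimedean seminorms on K over k. -/
def IsNASeminorm (f : K → ℝ) : Prop :=
  (∀ x, 0 ≤ f x) ∧ (∀ x y, f (x + y) ≤ max (f x) (f y)) ∧
    ∀ (c : k) (x : K), f (c • x) = absk p k c * f x

/-- The locally convex topology determined by a family of seminorms. -/
def seminormFamilyTop (F : Set (K → ℝ)) : TopologicalSpace K :=
  TopologicalSpace.generateFrom
    {U | ∃ f ∈ F, ∃ x : K, ∃ ε : ℝ, 0 < ε ∧ U = {y : K | f (y - x) < ε}}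

/-- The inductive limit topology on K: the finest locally convex topology over k
making all the inclusions Kₙ → K continuous. -/
def indTop (Knorm : K → ℝ) : TopologicalSpace K :=
  sInf {t : TopologicalSpace K |
    (∃ F : Set (K → ℝ), (∀ f ∈ F, IsNASeminorm p k K f) ∧ t = seminormFamilyTop K F) ∧
    ∀ n : ℕ, @Continuous _ _ (KnTop k K Kn Knorm n) t Subtype.val}

/-- Locally constant functions with bounded (hence compact) support on Kₙ. -/
def IsTestFun (Knorm : K → ℝ) (n : ℕ) (φ : Kn n → ℂ) : Prop :=
  @IsLocallyConstant _ _ (KnTop k K Kn Knorm n) φ ∧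
    ∃ R : ℝ, ∀ ξ : Kn n, R < Knorm ↑ξ → φ ξ = 0


/-- The fractional differentiation operator Dᵅ applied to the cylindrical function φ ∘ Tₙ. -/
def Dop (Knorm : K → ℝ) (χ : k → ℂ) (pairing : K → ProjLim k K Kn T → k)
    (vol : ∀ n : ℕ, @MeasureTheory.Measure (Kn n) (KnMeas k K Kn Knorm n))
    (μ : @MeasureTheory.Measure (ProjLim k K Kn T) (projMeas k K Kn T Knorm))
    (α : ℝ) (n : ℕ) (φ : Kn n → ℂ) (x : ProjLim k K Kn T) : ℂ :=
  ∫ ξ : Kn n,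
    χ ((finrank k (Kn n) : k)⁻¹ *
        Algebra.trace k (Kn n) (-(⟨x.1 n, x.2.1 n⟩ * ξ))) *
      (if 1 < Knorm ↑ξ then ((Knorm ↑ξ ^ α : ℝ) : ℂ) else 0) *
      (∫ y, χ (pairing (↑ξ) y) * φ ⟨y.1 n, y.2.1 n⟩ ∂μ) ∂(vol n)
end

/-- A continuous unitary character of the additive group of a normed field. -/
structure IsUnitaryChar {L : Type} [NormedField L] (e : L → ℂ) : Prop where
  map_add : ∀ x y, e (x + y) = e x * e y
  norm_eq_one : ∀ x, ‖e x‖ = 1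
  continuous : Continuous e

/-- The annihilator of the unit ball under the pairing `(ξ, z) ↦ e (ξ * z)`. -/
def unitBallDual {L : Type} [NormedField L] (e : L → ℂ) : Set L :=
  {z | ∀ ξ : L, ‖ξ‖ ≤ 1 → e (ξ * z) = 1}

namespace IsUnitaryChar

section Basic

variable {L : Type} [NormedField L] {e : L → ℂ}

theorem ne_zero (he : IsUnitaryChar e) (x : L) : e x ≠ 0 :=
  norm_ne_zero_iff.mp (by rw [he.norm_eq_one]; exact one_ne_zero)

theorem map_zero (he : IsUnitaryChar e) : e 0 = 1 := by
  have h := he.map_add 0 0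
  rw [add_zero] at h
  exact (mul_eq_left₀ (he.ne_zero 0)).mp h.symm

theorem neg_mul_self (he : IsUnitaryChar e) (x : L) : e (-x) * e x = 1 := by
  rw [← he.map_add, neg_add_cancel, he.map_zero]

theorem eq_of_sub (he : IsUnitaryChar e) {x y : L} (h : e (x - y) = 1) : e x = e y := by
  rw [← sub_add_cancel x y, he.map_add, h, one_mul]

theorem map_neg_eq_one (he : IsUnitaryChar e) {x : L} (h : e x = 1) : e (-x) = 1 := by
  have := he.neg_mul_self x
  rwa [h, mul_one] at this

/-- The annihilator of the unit ball as a subgroup. -/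
def dualSubgroup (he : IsUnitaryChar e) : AddSubgroup L where
  carrier := unitBallDual e
  zero_mem' := fun ξ _ => by rw [mul_zero, he.map_zero]
  add_mem' := fun {a b} ha hb ξ hξ => by rw [mul_add, he.map_add, ha ξ hξ, hb ξ hξ, one_mul]
  neg_mem' := fun {a} ha ξ hξ => by
    rw [mul_neg]
    exact he.map_neg_eq_one (ha ξ hξ)

theorem isClosed_dual (he : IsUnitaryChar e) : IsClosed (unitBallDual e) := by
  have : unitBallDual e = ⋂ ξ : L, ⋂ _ : ‖ξ‖ ≤ 1, {z | e (ξ * z) = 1} := by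
    ext z; simp [unitBallDual]
  rw [this]
  exact isClosed_iInter fun ξ => isClosed_iInter fun _ =>
    isClosed_eq (he.continuous.comp (continuous_const.mul continuous_id)) continuous_const

theorem isCompact_dual [ProperSpace L] (he : IsUnitaryChar e)
    (hbdd : Bornology.IsBounded (unitBallDual e)) : IsCompact (unitBallDual e) :=
  Metric.isCompact_of_isClosed_isBounded he.isClosed_dual hbdd

end Basic

theorem exists_delta_of_isLocallyConstant {L : Type} [NormedField L] {φ : L → ℂ}
    (hφ : IsLocallyConstant φ) {s : Set L} (hs : IsCompact s) :
    ∃ δ > 0, ∀ z ∈ s, ∀ w, ‖w‖ < δ → φ (z + w) = φ z := by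
  obtain ⟨δ, hδ, h⟩ := lebesgue_number_lemma_of_metric hs
    (c := fun a : ℂ => {x | φ x = a}) (fun a => hφ.isOpen_fiber a)
    (fun x _ => Set.mem_iUnion.mpr ⟨φ x, rfl⟩)
  refine ⟨δ, hδ, fun z hz w hw => ?_⟩
  obtain ⟨a, ha⟩ := h z hz
  have h1 : φ z = a := ha (Metric.mem_ball_self hδ)
  have h2 : φ (z + w) = a := ha (by simpa [Metric.mem_ball] using hw)
  rw [h1, h2]

section Expansion

variable {L : Type} [NontriviallyNormedField L] [IsUltrametricDist L] [ProperSpace L] {e : L → ℂ}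

/-- The indicator function of a small dilate `c • B` of the dual `B` of the unit ball is,
on `B`, an average of finitely many characters. -/
theorem exists_indicator_expansion (he : IsUnitaryChar e) {c : L} (hc : c ≠ 0) :
    ∃ (Q : Type) (_ : Fintype Q) (η : Q → L) (a : ℂ), ∀ z ∈ unitBallDual e,
      (if c⁻¹ * z ∈ unitBallDual e then (1 : ℂ) else 0) = a * ∑ q, e (η q * z) := by
  have hcn : 0 < ‖c⁻¹‖ := norm_pos_iff.mpr (inv_ne_zero hc)
  let A : AddSubgroup L := (IsUltrametricDist.closedBall_openAddSubgroup L hcn).toAddSubgroup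
  let O : AddSubgroup L :=
    (IsUltrametricDist.closedBall_openAddSubgroup L (zero_lt_one' ℝ)).toAddSubgroup
  have hA : ∀ x : L, x ∈ A ↔ ‖x‖ ≤ ‖c⁻¹‖ := fun x => mem_closedBall_zero_iff
  have hO : ∀ x : L, x ∈ O ↔ ‖x‖ ≤ 1 := fun x => mem_closedBall_zero_iff
  have hOo : IsOpen (O : Set L) :=
    (IsUltrametricDist.closedBall_openAddSubgroup L (zero_lt_one' ℝ)).isOpen'
  have : CompactSpace A := isCompact_iff_compactSpace.mp (isCompact_closedBall (0 : L) ‖c⁻¹‖)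
  have : Finite (A ⧸ O.addSubgroupOf A) :=
    AddSubgroup.quotient_finite_of_isOpen _ (hOo.preimage continuous_subtype_val)
  let _ : Fintype (A ⧸ O.addSubgroupOf A) := Fintype.ofFinite _
  have hmk : ∀ z ∈ unitBallDual e, ∀ x : A,
      e (((Quotient.out (x : A ⧸ O.addSubgroupOf A) : A) : L) * z) = e ((x : L) * z) := by
    intro z hz x
    have h1 := QuotientAddGroup.eq.mp (QuotientAddGroup.out_eq' (x : A ⧸ O.addSubgroupOf A)).symm
    rw [AddSubgroup.mem_addSubgroupOf, hO] at h1
    apply he.eq_of_sub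
    rw [← sub_mul]
    apply hz
    rw [sub_eq_neg_add]
    exact h1
  refine ⟨A ⧸ O.addSubgroupOf A, inferInstance, fun q => ((Quotient.out q : A) : L),
    (Fintype.card (A ⧸ O.addSubgroupOf A) : ℂ)⁻¹, fun z hz => ?_⟩
  have hcard : (Fintype.card (A ⧸ O.addSubgroupOf A) : ℂ) ≠ 0 :=
    Nat.cast_ne_zero.mpr Fintype.card_ne_zero
  split_ifs with h
  · have : ∀ q : A ⧸ O.addSubgroupOf A, e (((Quotient.out q : A) : L) * z) = 1 := by
      intro q
      have h1 := (hA _).mp (Quotient.out q : A).2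
      have h2 := h (((Quotient.out q : A) : L) * c) (by
        rw [norm_mul]
        calc _ ≤ ‖c⁻¹‖ * ‖c‖ := by gcongr
          _ = 1 := by rw [norm_inv, inv_mul_cancel₀ (norm_ne_zero_iff.mpr hc)])
      rwa [mul_assoc, mul_inv_cancel_left₀ hc] at h2
    rw [Finset.sum_congr rfl fun q _ => this q]
    simp [hcard]
  · have h' : ∃ ξ : L, ‖ξ‖ ≤ 1 ∧ e (ξ * (c⁻¹ * z)) ≠ 1 := by
      simpa [unitBallDual] using h
    obtain ⟨ξ, hξ, hne⟩ := h'
    let η : A := ⟨ξ * c⁻¹, (hA _).mpr (by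
      rw [norm_mul]; exact mul_le_of_le_one_left (norm_nonneg _) hξ)⟩
    have hsum : e ((η : L) * z) * ∑ q : A ⧸ O.addSubgroupOf A, e (((Quotient.out q : A) : L) * z)
        = ∑ q : A ⧸ O.addSubgroupOf A, e (((Quotient.out q : A) : L) * z) := by
      rw [Finset.mul_sum]
      refine Fintype.sum_equiv (Equiv.addLeft (η : A ⧸ O.addSubgroupOf A)) _ _ fun q => ?_
      rw [← he.map_add, ← add_mul]
      have h3 : Equiv.addLeft (η : A ⧸ O.addSubgroupOf A) q =
          ((η + Quotient.out q : A) : A ⧸ O.addSubgroupOf A) := by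
        rw [QuotientAddGroup.mk_add, QuotientAddGroup.out_eq']; rfl
      rw [h3, hmk z hz]
      rfl
    have hne' : e ((η : L) * z) ≠ 1 := by rw [← mul_assoc] at hne; exact hne
    have : ∑ q : A ⧸ O.addSubgroupOf A, e (((Quotient.out q : A) : L) * z) = 0 := by
      by_contra h0
      exact hne' ((mul_eq_right₀ h0).mp hsum)
    rw [this, mul_zero]

/-- A locally constant function is a finite combination of characters on the dual of the
unit ball. -/
theorem exists_character_expansion (he : IsUnitaryChar e)
    (hbdd : Bornology.IsBounded (unitBallDual e)) (hnhds : unitBallDual e ∈ nhds (0 : L))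
    {φ : L → ℂ} (hφ : IsLocallyConstant φ) :
    ∃ (ι : Type) (_ : Fintype ι) (c : ι → ℂ) (ξ : ι → L),
      ∀ z ∈ unitBallDual e, φ z = ∑ i, c i * e (ξ i * z) := by
  have hcomp := he.isCompact_dual hbdd
  obtain ⟨δ, hδ, hloc⟩ := exists_delta_of_isLocallyConstant hφ hcomp
  obtain ⟨R, hR⟩ := hbdd.exists_norm_le
  obtain ⟨c, hc0, hcs⟩ := NormedField.exists_norm_lt L
    (show 0 < δ / (|R| + 1) by positivity)
  have hc : c ≠ 0 := norm_pos_iff.mp hc0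
  have hshift : ∀ z ∈ unitBallDual e, ∀ w, c⁻¹ * w ∈ unitBallDual e → φ (z + w) = φ z := by
    intro z hz w hw
    apply hloc z hz
    have h1 : ‖c⁻¹ * w‖ ≤ |R| := (hR _ hw).trans (le_abs_self _)
    calc ‖w‖ = ‖c‖ * ‖c⁻¹ * w‖ := by rw [← norm_mul, mul_inv_cancel_left₀ hc]
      _ ≤ ‖c‖ * |R| := by gcongr
      _ ≤ ‖c‖ * (|R| + 1) := by gcongr; linarith
      _ < δ / (|R| + 1) * (|R| + 1) := by gcongr
      _ = δ := by field_simp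
  obtain ⟨Q, _, η, a, hind⟩ := he.exists_indicator_expansion hc
  let B := he.dualSubgroup
  let C : AddSubgroup L := B.comap (AddMonoidHom.mulLeft c⁻¹)
  have hCo : IsOpen (C : Set L) := by
    apply AddSubgroup.isOpen_of_mem_nhds C (g := 0)
    have : Filter.Tendsto (fun x : L => c⁻¹ * x) (nhds 0) (nhds 0) := by
      have := (continuous_const_mul c⁻¹).tendsto (0 : L)
      rwa [mul_zero] at this
    exact this hnhds
  have : CompactSpace B := isCompact_iff_compactSpace.mp hcomp
  have : Finite (B ⧸ C.addSubgroupOf B) :=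
    AddSubgroup.quotient_finite_of_isOpen _ (hCo.preimage continuous_subtype_val)
  let _ : Fintype (B ⧸ C.addSubgroupOf B) := Fintype.ofFinite _
  let r : B ⧸ C.addSubgroupOf B → L := fun x => ((Quotient.out x : B) : L)
  have hr : ∀ x, r x ∈ unitBallDual e := fun x => (Quotient.out x : B).2
  refine ⟨(B ⧸ C.addSubgroupOf B) × Q, inferInstance,
    fun i => φ (r i.1) * a * e (-(η i.2 * r i.1)), fun i => η i.2, fun z hz => ?_⟩
  have hsub : ∀ x, z - r x ∈ unitBallDual e := fun x => he.dualSubgroup.sub_mem hz (hr x)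
  have hiff : ∀ x, c⁻¹ * (z - r x) ∈ unitBallDual e ↔
      x = ((⟨z, hz⟩ : B) : B ⧸ C.addSubgroupOf B) := by
    intro x
    conv_rhs => rw [← QuotientAddGroup.out_eq' x, QuotientAddGroup.eq,
      AddSubgroup.mem_addSubgroupOf]
    rw [sub_eq_neg_add]
    rfl
  have key : φ z = ∑ x, φ (r x) * (if c⁻¹ * (z - r x) ∈ unitBallDual e then (1 : ℂ) else 0) := by
    rw [Finset.sum_eq_single ((⟨z, hz⟩ : B) : B ⧸ C.addSubgroupOf B)]
    · rw [if_pos ((hiff _).mpr rfl), mul_one]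
      have := hshift _ (hr ((⟨z, hz⟩ : B) : B ⧸ C.addSubgroupOf B)) _ ((hiff _).mpr rfl)
      rwa [add_sub_cancel] at this
    · intro x _ hx
      rw [if_neg (fun h => hx ((hiff x).mp h)), mul_zero]
    · intro h; exact absurd (Finset.mem_univ _) h
  rw [key, Fintype.sum_prod_type]
  refine Finset.sum_congr rfl fun x _ => ?_
  rw [hind _ (hsub x), Finset.mul_sum, Finset.mul_sum]
  refine Finset.sum_congr rfl fun q _ => ?_
  rw [mul_sub, sub_eq_neg_add, he.map_add]
  ring

end Expansion

section Measure

variable {L : Type} [NontriviallyNormedField L] {e : L → ℂ} {Ω : Type} [MeasurableSpace Ω]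
  {Y : Ω → L}

theorem integrable_comp [MeasurableSpace L] [BorelSpace L] (he : IsUnitaryChar e)
    (hY : Measurable Y) (ν : Measure Ω)
    [IsProbabilityMeasure ν] (ξ : L) : Integrable (fun y => e (ξ * Y y)) ν := by
  refine Integrable.of_bound (C := 1) ?_ (Filter.Eventually.of_forall fun y => ?_)
  · exact (he.continuous.measurable.comp
      ((continuous_const_mul ξ).measurable.comp hY)).aestronglyMeasurable
  · rw [he.norm_eq_one]

/-- A random variable whose characteristic function is one on the unit ball almost surely takes
values in the dual of the unit ball. -/
theorem ae_mem_dual [ProperSpace L] [MeasurableSpace L] [BorelSpace L] (he : IsUnitaryChar e)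
    (hY : Measurable Y) (ν : Measure Ω)
    [IsProbabilityMeasure ν] (hν : ∀ ξ : L, ‖ξ‖ ≤ 1 → ∫ y, e (ξ * Y y) ∂ν = 1) :
    ∀ᵐ y ∂ν, Y y ∈ unitBallDual e := by
  have hone : ∀ ξ : L, ‖ξ‖ ≤ 1 → ∀ᵐ y ∂ν, e (ξ * Y y) = 1 := by
    intro ξ hξ
    have hint := he.integrable_comp hY ν ξ
    have hre : Integrable (fun y => 1 - (e (ξ * Y y)).re) ν :=
      (integrable_const 1).sub hint.re
    have hle : ∀ y, (e (ξ * Y y)).re ≤ 1 := fun y =>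
      (Complex.re_le_norm _).trans_eq (he.norm_eq_one _)
    have hzero : ∫ y, (1 - (e (ξ * Y y)).re) ∂ν = 0 := by
      have h1 : ∫ y, (e (ξ * Y y)).re ∂ν = 1 := by
        have := integral_re hint
        rw [hν ξ hξ] at this
        simpa using this
      rw [integral_sub (g := fun y => (e (ξ * Y y)).re) (integrable_const 1) hint.re, h1]
      simp
    have hae := (integral_eq_zero_iff_of_nonneg (fun y => sub_nonneg.mpr (hle y)) hre).mp hzero
    filter_upwards [hae] with y hy
    have hre1 : (e (ξ * Y y)).re = 1 := by
      have : 1 - (e (ξ * Y y)).re = 0 := hy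
      linarith
    have hn := Complex.sq_norm (e (ξ * Y y))
    rw [he.norm_eq_one, Complex.normSq_apply, hre1] at hn
    refine Complex.ext hre1 ?_
    have : (e (ξ * Y y)).im * (e (ξ * Y y)).im = 0 := by linarith
    simpa using this
  obtain ⟨D, hDc, hDd⟩ := TopologicalSpace.exists_countable_dense (Metric.closedBall (0 : L) 1)
  have hall : ∀ᵐ y ∂ν, ∀ ξ ∈ D, e ((ξ : L) * Y y) = 1 :=
    (ae_ball_iff hDc).mpr fun ξ _ => hone ξ (mem_closedBall_zero_iff.mp ξ.2)
  filter_upwards [hall] with y hy ξ hξ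
  have hcl : IsClosed {η : Metric.closedBall (0 : L) 1 | e ((η : L) * Y y) = 1} :=
    isClosed_eq (he.continuous.comp (continuous_subtype_val.mul continuous_const))
      continuous_const
  have hsub : closure D ⊆ {η : Metric.closedBall (0 : L) 1 | e ((η : L) * Y y) = 1} :=
    hcl.closure_subset_iff.mpr hy
  exact hsub (hDd ⟨ξ, mem_closedBall_zero_iff.mpr hξ⟩)

theorem integral_shift_eq_sum [MeasurableSpace L] [BorelSpace L] (he : IsUnitaryChar e)
    (hY : Measurable Y) (ν : Measure Ω)
    [IsProbabilityMeasure ν] (hν : ∀ᵐ y ∂ν, Y y ∈ unitBallDual e)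
    {φ : L → ℂ} {ι : Type} [Fintype ι] {c : ι → ℂ} {ξ : ι → L}
    (hφ : ∀ z ∈ unitBallDual e, φ z = ∑ i, c i * e (ξ i * z)) {x : L} (hx : x ∈ unitBallDual e) :
    ∫ y, φ (x + Y y) ∂ν = ∑ i, c i * e (ξ i * x) * ∫ y, e (ξ i * Y y) ∂ν := by
  have h1 : (fun y => φ (x + Y y)) =ᵐ[ν] fun y => ∑ i, c i * e (ξ i * x) * e (ξ i * Y y) := by
    filter_upwards [hν] with y hy
    rw [hφ _ (he.dualSubgroup.add_mem hx hy)]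
    refine Finset.sum_congr rfl fun i _ => ?_
    rw [mul_add, he.map_add, mul_assoc]
  rw [integral_congr_ae h1, integral_finsetSum _
    fun i _ => (he.integrable_comp hY ν (ξ i)).const_mul _]
  exact Finset.sum_congr rfl fun i _ => integral_const_mul _ _

theorem isLocallyConstant_integral_shift [ProperSpace L] (he : IsUnitaryChar e)
    (hbdd : Bornology.IsBounded (unitBallDual e)) (ν : Measure Ω)
    (hν : ∀ᵐ y ∂ν, Y y ∈ unitBallDual e) {φ : L → ℂ} (hφ : IsLocallyConstant φ) :
    IsLocallyConstant (fun z => ∫ y, φ (z + Y y) ∂ν) := by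
  rw [IsLocallyConstant.iff_eventually_eq]
  intro x
  obtain ⟨δ, hδ, h⟩ := exists_delta_of_isLocallyConstant
    (hφ.comp_continuous (continuous_const_add x)) (he.isCompact_dual hbdd)
  filter_upwards [Metric.ball_mem_nhds x hδ] with z hz
  refine integral_congr_ae ?_
  filter_upwards [hν] with y hy
  have := h (Y y) hy (z - x) (mem_ball_iff_norm.mp hz)
  simp only [Function.comp_apply] at this
  rw [← this]
  congr 1
  ring

/-- The generator property: differentiating the convolution with the measures `π t` whose
characteristic functions are `exp (-t * N ξ ^ α)` off the unit ball gives minus the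
pseudodifferential operator with symbol `N ξ ^ α`. -/
theorem hasDerivAt_integral_shift [IsUltrametricDist L] [ProperSpace L]
    [MeasurableSpace L] [BorelSpace L] (he : IsUnitaryChar e) (hY : Measurable Y)
    (hbdd : Bornology.IsBounded (unitBallDual e)) (hnhds : unitBallDual e ∈ nhds (0 : L))
    {N : L → ℝ} (hN1 : ∀ ξ, N ξ ≤ 1 ↔ ‖ξ‖ ≤ 1) (hNcongr : ∀ ξ η, ‖ξ‖ = ‖η‖ → N ξ = N η)
    {vol : Measure L}
    (hinv : ∀ (a : L) (A : Set L), MeasurableSet A → vol ((fun z => a + z) ⁻¹' A) = vol A)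
    (hvol : vol {z | N z ≤ 1} = 1) {μ : Measure Ω} [IsProbabilityMeasure μ]
    (hμ : ∀ ξ, ∫ y, e (ξ * Y y) ∂μ = if N ξ ≤ 1 then (1 : ℂ) else 0) {α : ℝ}
    {π : ℝ → Measure Ω} (hπprob : ∀ t, 0 < t → IsProbabilityMeasure (π t))
    (hπ : ∀ t, 0 < t → ∀ ξ, ∫ y, e (ξ * Y y) ∂(π t) =
      (((if N ξ ≤ 1 then (1 : ℝ) else Real.exp (-t * N ξ ^ α)) : ℝ) : ℂ))
    {φ : L → ℂ} (hφ : IsLocallyConstant φ) {x : L} (hx : x ∈ unitBallDual e)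
    {t : ℝ} (ht : 0 < t) :
    HasDerivAt (fun s => ∫ y, φ (x + Y y) ∂(π s))
      (-(∫ ξ, e (-(x * ξ)) * (if 1 < N ξ then ((N ξ ^ α : ℝ) : ℂ) else 0) *
        (∫ y, e (ξ * Y y) * (∫ y', φ (Y y + Y y') ∂(π t)) ∂μ) ∂vol)) t := by
  obtain ⟨ι, _, c, ξ, hexp⟩ := he.exists_character_expansion hbdd hnhds hφ
  have hπae : ∀ s, 0 < s → ∀ᵐ y ∂(π s), Y y ∈ unitBallDual e := fun s hs => by
    have := hπprob s hs
    exact he.ae_mem_dual hY (π s) fun ξ hξ => by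
      rw [hπ s hs, if_pos ((hN1 ξ).mpr hξ), Complex.ofReal_one]
  have hμae : ∀ᵐ y ∂μ, Y y ∈ unitBallDual e := he.ae_mem_dual hY μ fun ξ hξ => by
    rw [hμ, if_pos ((hN1 ξ).mpr hξ)]
  let ρ : ℝ → ι → ℝ := fun s i => if N (ξ i) ≤ 1 then (1 : ℝ) else Real.exp (-s * N (ξ i) ^ α)
  have hu : ∀ s, 0 < s → ∀ z ∈ unitBallDual e,
      ∫ y, φ (z + Y y) ∂(π s) = ∑ i, c i * e (ξ i * z) * (ρ s i : ℂ) := fun s hs z hz => by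
    have := hπprob s hs
    rw [he.integral_shift_eq_sum hY (π s) (hπae s hs) hexp hz]
    exact Finset.sum_congr rfl fun i _ => by rw [hπ s hs]
  let Δ : L → ℂ := fun η => if 1 < N η then ((N η ^ α : ℝ) : ℂ) else 0
  have hderiv : HasDerivAt (fun s => ∑ i, c i * e (ξ i * x) * (ρ s i : ℂ))
      (∑ i, c i * e (ξ i * x) * (-(Δ (ξ i) * (ρ t i : ℂ)))) t := by
    refine HasDerivAt.fun_sum fun i _ => HasDerivAt.const_mul _ ?_
    by_cases h : N (ξ i) ≤ 1
    · simp only [ρ, Δ, if_pos h, if_neg (not_lt.mpr h), zero_mul, neg_zero]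
      exact hasDerivAt_const _ _
    · simp only [ρ, Δ, if_neg h, if_pos (not_le.mp h)]
      have h1 : HasDerivAt (fun s : ℝ => Real.exp (-s * N (ξ i) ^ α))
          (Real.exp (-t * N (ξ i) ^ α) * (-1 * N (ξ i) ^ α)) t :=
        (((hasDerivAt_id t).neg).mul_const _).exp
      refine h1.ofReal_comp.congr_deriv ?_
      push_cast
      ring
  have hev : (fun s => ∫ y, φ (x + Y y) ∂(π s)) =ᶠ[nhds t]
      fun s => ∑ i, c i * e (ξ i * x) * (ρ s i : ℂ) := by
    filter_upwards [lt_mem_nhds ht] with s hs using hu s hs x hx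
  refine (hderiv.congr_of_eventuallyEq hev).congr_deriv ?_
  have hhat : ∀ η, ∫ y, e (η * Y y) * (∫ y', φ (Y y + Y y') ∂(π t)) ∂μ =
      ∑ i, c i * (ρ t i : ℂ) * (if N (ξ i + η) ≤ 1 then (1 : ℂ) else 0) := fun η => by
    have h1 : (fun y => e (η * Y y) * (∫ y', φ (Y y + Y y') ∂(π t))) =ᵐ[μ]
        fun y => ∑ i, c i * (ρ t i : ℂ) * e ((ξ i + η) * Y y) := by
      filter_upwards [hμae] with y hy
      rw [hu t ht _ hy, Finset.mul_sum]
      refine Finset.sum_congr rfl fun i _ => ?_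
      rw [add_mul, he.map_add]
      ring
    rw [integral_congr_ae h1, integral_finsetSum _
      fun i _ => (he.integrable_comp hY μ _).const_mul _]
    exact Finset.sum_congr rfl fun i _ => by rw [integral_const_mul, hμ]
  have hball : {z : L | N z ≤ 1} = Metric.closedBall 0 1 := by
    ext z; simp [hN1]
  have hmeas : MeasurableSet {z : L | N z ≤ 1} := by
    rw [hball]; exact Metric.isClosed_closedBall.measurableSet
  let A : ι → Set L := fun i => (fun z => ξ i + z) ⁻¹' {z : L | N z ≤ 1}
  have hAmeas : ∀ i, MeasurableSet (A i) := fun i =>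
    (continuous_const_add (ξ i)).measurable hmeas
  have hAvol : ∀ i, vol (A i) = 1 := fun i => by rw [hinv _ _ hmeas, hvol]
  have hkey : ∀ i η, e (-(x * η)) * Δ η *
      (c i * (ρ t i : ℂ) * (if N (ξ i + η) ≤ 1 then (1 : ℂ) else 0)) =
      (A i).indicator (fun _ => c i * e (ξ i * x) * (Δ (ξ i) * (ρ t i : ℂ))) η := by
    intro i η
    by_cases h : N (ξ i + η) ≤ 1
    · rw [if_pos h, Set.indicator_of_mem (show η ∈ A i from h)]
      have hn : ‖ξ i + η‖ ≤ 1 := (hN1 _).mp h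
      have he' : e (-(x * η)) = e (ξ i * x) := by
        refine (he.eq_of_sub ?_).symm
        have := hx _ hn
        rwa [show ξ i * x - -(x * η) = (ξ i + η) * x by ring]
      have hΔ : Δ η = Δ (ξ i) := by
        by_cases h1 : ‖ξ i‖ ≤ 1
        · have h2 : ‖η‖ ≤ 1 := by
            rw [← neg_add_cancel_left (ξ i) η]
            exact (IsUltrametricDist.norm_add_le_max _ _).trans
              (max_le (by rwa [norm_neg]) hn)
          simp only [Δ, if_neg (not_lt.mpr ((hN1 _).mpr h1)), if_neg (not_lt.mpr ((hN1 _).mpr h2))]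
        · have h2 : ‖ξ i‖ = ‖η‖ := IsUltrametricDist.norm_eq_of_add_norm_lt_max
            (hn.trans_lt ((not_le.mp h1).trans_le (le_max_left _ _)))
          simp only [Δ, hNcongr _ _ h2]
      rw [he', hΔ]
      ring
    · rw [if_neg h, Set.indicator_of_notMem (show η ∉ A i from h)]
      ring
  have hfun : (fun η => e (-(x * η)) * (if 1 < N η then ((N η ^ α : ℝ) : ℂ) else 0) *
      (∫ y, e (η * Y y) * (∫ y', φ (Y y + Y y') ∂(π t)) ∂μ)) =
      fun η => ∑ i, (A i).indicator
        (fun _ => c i * e (ξ i * x) * (Δ (ξ i) * (ρ t i : ℂ))) η := by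
    ext η
    rw [hhat, Finset.mul_sum]
    exact Finset.sum_congr rfl fun i _ => hkey i η
  rw [hfun, integral_finsetSum _ fun i _ => (integrable_indicator_iff (hAmeas i)).mpr
    (integrableOn_const (by rw [hAvol i]; exact ENNReal.one_ne_top)), ← Finset.sum_neg_distrib]
  refine Finset.sum_congr rfl fun i _ => ?_
  rw [integral_indicator_const _ (hAmeas i), Measure.real, hAvol i]
  simp

theorem tendsto_integral_shift [IsUltrametricDist L] [ProperSpace L]
    [MeasurableSpace L] [BorelSpace L] (he : IsUnitaryChar e) (hY : Measurable Y)
    (hbdd : Bornology.IsBounded (unitBallDual e)) (hnhds : unitBallDual e ∈ nhds (0 : L))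
    {N : L → ℝ} (hN1 : ∀ ξ, N ξ ≤ 1 ↔ ‖ξ‖ ≤ 1) {α : ℝ}
    {π : ℝ → Measure Ω} (hπprob : ∀ t, 0 < t → IsProbabilityMeasure (π t))
    (hπ : ∀ t, 0 < t → ∀ ξ, ∫ y, e (ξ * Y y) ∂(π t) =
      (((if N ξ ≤ 1 then (1 : ℝ) else Real.exp (-t * N ξ ^ α)) : ℝ) : ℂ))
    {φ : L → ℂ} (hφ : IsLocallyConstant φ) {x : L} (hx : x ∈ unitBallDual e) :
    Filter.Tendsto (fun t => ∫ y, φ (x + Y y) ∂(π t)) (nhdsWithin 0 (Set.Ioi 0))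
      (nhds (φ x)) := by
  obtain ⟨ι, _, c, ξ, hexp⟩ := he.exists_character_expansion hbdd hnhds hφ
  have hu : ∀ s, 0 < s → ∫ y, φ (x + Y y) ∂(π s) = ∑ i, c i * e (ξ i * x) *
      (((if N (ξ i) ≤ 1 then (1 : ℝ) else Real.exp (-s * N (ξ i) ^ α)) : ℝ) : ℂ) := fun s hs => by
    have := hπprob s hs
    rw [he.integral_shift_eq_sum hY (π s) (he.ae_mem_dual hY (π s) fun ξ hξ => by
      rw [hπ s hs, if_pos ((hN1 ξ).mpr hξ), Complex.ofReal_one]) hexp hx]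
    exact Finset.sum_congr rfl fun i _ => by rw [hπ s hs]
  have hlim : Filter.Tendsto (fun s : ℝ => ∑ i, c i * e (ξ i * x) *
      (((if N (ξ i) ≤ 1 then (1 : ℝ) else Real.exp (-s * N (ξ i) ^ α)) : ℝ) : ℂ))
      (nhds 0) (nhds (φ x)) := by
    have hcont : Continuous (fun s : ℝ => ∑ i, c i * e (ξ i * x) *
        (((if N (ξ i) ≤ 1 then (1 : ℝ) else Real.exp (-s * N (ξ i) ^ α)) : ℝ) : ℂ)) := by
      refine continuous_finsetSum _ fun i _ => continuous_const.mul ?_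
      by_cases h : N (ξ i) ≤ 1
      · simp only [if_pos h]; exact continuous_const
      · simp only [if_neg h]; fun_prop
    convert hcont.tendsto 0 using 2
    rw [hexp x hx]
    simp
  refine (hlim.mono_left nhdsWithin_le_nhds).congr' ?_
  filter_upwards [self_mem_nhdsWithin] with s hs using (hu s hs).symm

end Measure

end IsUnitaryChar

theorem continuous_of_isOpen_norm_pow_lt {Z X : Type} [TopologicalSpace Z]
    [SeminormedAddCommGroup X] {f : X → ℝ} {E : ℕ} (hE : E ≠ 0) (hf : ∀ x, f x = ‖x‖ ^ E)
    {Y : Z → X} (hY : ∀ z₀ : Z, ∀ ε > 0, IsOpen {z | f (Y z - Y z₀) < ε}) : Continuous Y := by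
  rw [continuous_iff_continuousAt]
  intro z₀
  rw [ContinuousAt, Metric.tendsto_nhds]
  intro ε hε
  have hmem : z₀ ∈ {z | f (Y z - Y z₀) < ε ^ E} := by
    simp [hf, hE, hε]
  filter_upwards [(hY z₀ (ε ^ E) (pow_pos hε E)).mem_nhds hmem] with z hz
  have hz' : ‖Y z - Y z₀‖ ^ E < ε ^ E := by rw [← hf]; exact hz
  rw [dist_eq_norm]
  exact (pow_lt_pow_iff_left₀ (norm_nonneg _) hε.le hE).mp hz'

theorem normTopology_eq_of_norm_pow {X : Type} [SeminormedAddCommGroup X] {f : X → ℝ} {E : ℕ}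
    (hE : E ≠ 0) (hf : ∀ x, f x = ‖x‖ ^ E) :
    normTopology f = (inferInstance : TopologicalSpace X) := by
  apply le_antisymm
  · rw [← continuous_id_iff_le]
    refine @continuous_of_isOpen_norm_pow_lt X X (normTopology f) _ f E hE hf id
      fun z₀ ε hε => ?_
    exact TopologicalSpace.isOpen_generateFrom_of_mem ⟨z₀, ε, hε, rfl⟩
  · apply le_generateFrom
    rintro _ ⟨x, ε, -, rfl⟩
    simp only [hf]
    exact isOpen_lt (by fun_prop) continuous_const

theorem induced_eq_of_norm_eq {X X' F : Type} [SeminormedAddCommGroup X]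
    [SeminormedAddCommGroup X'] [FunLike F X' X] [AddMonoidHomClass F X' X] (i : F)
    (hi : ∀ x, ‖i x‖ = ‖x‖) :
    TopologicalSpace.induced i inferInstance = (inferInstance : TopologicalSpace X') :=
  (AddMonoidHomClass.isometry_of_norm i hi).isUniformInducing.isInducing.eq_induced.symm

section Padic

variable {p : ℕ} [Fact (Nat.Prime p)]

theorem norm_algebraNorm_eq_spectralNorm_pow (L : Type) [Field L] [Algebra ℚ_[p] L]
    [FiniteDimensional ℚ_[p] L] (x : L) :
    ‖Algebra.norm ℚ_[p] x‖ = spectralNorm ℚ_[p] L x ^ finrank ℚ_[p] L := by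
  have hx : IsIntegral ℚ_[p] x := Algebra.IsIntegral.isIntegral x
  have hdeg : (minpoly ℚ_[p] x).natDegree ≠ 0 := (minpoly.natDegree_pos hx).ne'
  have hs : spectralNorm ℚ_[p] L x ^ (minpoly ℚ_[p] x).natDegree =
      ‖(minpoly ℚ_[p] x).coeff 0‖ := by
    rw [spectralNorm.spectralNorm_eq_norm_coeff_zero_rpow, one_div,
      Real.rpow_inv_natCast_pow (norm_nonneg _) hdeg]
  have hgen := Algebra.PowerBasis.norm_gen_eq_coeff_zero_minpoly
    (IntermediateField.adjoin.powerBasis hx)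
  rw [IntermediateField.adjoin.powerBasis_gen, IntermediateField.minpoly_gen] at hgen
  rw [Algebra.norm_eq_norm_adjoin, hgen, norm_pow, norm_mul, norm_pow, norm_neg, norm_one, one_pow,
    one_mul, ← hs, ← pow_mul, ← IntermediateField.adjoin.finrank hx,
    finrank_mul_finrank]

variable {k : Type} [Field k] [Algebra ℚ_[p] k]
  {K : Type} [Field K] [Algebra k K] [Algebra ℚ_[p] K] [IsScalarTower ℚ_[p] k K]

theorem isScalarTower_padic (Kn : ℕ → IntermediateField k K) (n : ℕ) :
    IsScalarTower ℚ_[p] (Kn n) K :=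
  IsScalarTower.of_algebraMap_eq fun x => by
    rw [IsScalarTower.algebraMap_apply ℚ_[p] k (Kn n), IsScalarTower.algebraMap_apply ℚ_[p] k K]
    rfl

variable [FiniteDimensional ℚ_[p] k]

theorem absk_inv (x : k) : absk p k x⁻¹ = (absk p k x)⁻¹ := by
  rcases eq_or_ne x 0 with rfl | hx
  · simp [absk, Algebra.norm_zero]
  · rw [absk, absk, ← norm_inv, eq_inv_of_mul_eq_one_left
      (by rw [← map_mul, inv_mul_cancel₀ hx, map_one] :
        Algebra.norm ℚ_[p] x⁻¹ * Algebra.norm ℚ_[p] x = 1)]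

theorem absk_eq_spectralNorm_pow (x : k) :
    absk p k x = spectralNorm ℚ_[p] k x ^ finrank ℚ_[p] k :=
  norm_algebraNorm_eq_spectralNorm_pow k x

theorem absk_norm_rpow_eq_spectralNorm_pow (F : IntermediateField k K) [FiniteDimensional k F]
    (x : F) : absk p k (Algebra.norm k x) ^ ((finrank k F : ℝ)⁻¹) =
      spectralNorm ℚ_[p] F x ^ finrank ℚ_[p] k := by
  have : FiniteDimensional ℚ_[p] F := FiniteDimensional.trans ℚ_[p] k F
  have hm : finrank k F ≠ 0 := finrank_pos.ne'
  rw [absk, Algebra.norm_norm, norm_algebraNorm_eq_spectralNorm_pow,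
    ← finrank_mul_finrank ℚ_[p] k F, pow_mul,
    Real.pow_rpow_inv_natCast (pow_nonneg (spectralNorm_nonneg _) _) hm]

theorem continuous_mul_trace {k L : Type} [NormedField k] [NormedAlgebra ℚ_[p] k]
    [NormedField L] [NormedAlgebra ℚ_[p] L] [FiniteDimensional ℚ_[p] L] [Algebra k L]
    [IsScalarTower ℚ_[p] k L] (a : k) : Continuous (fun z : L => a * Algebra.trace k L z) :=
  continuous_const.mul
    (LinearMap.continuous_of_finiteDimensional ((Algebra.trace k L).restrictScalars ℚ_[p]))

theorem KnTop_eq_spectralNorm [Algebra.IsAlgebraic ℚ_[p] K] {Knorm : K → ℝ}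
    (hK : ∀ x, Knorm x = spectralNorm ℚ_[p] K x ^ finrank ℚ_[p] k)
    (Kn : ℕ → IntermediateField k K) (n : ℕ) [FiniteDimensional ℚ_[p] (Kn n)] :
    KnTop k K Kn Knorm n =
      (spectralNorm.metricSpace ℚ_[p] (Kn n)).toUniformSpace.toTopologicalSpace := by
  have htower := isScalarTower_padic (p := p) Kn n
  rw [KnTop, @normTopology_eq_of_norm_pow K (spectralNorm.seminormedAddCommGroup ℚ_[p] K) Knorm
    (finrank ℚ_[p] k) finrank_pos.ne' hK]
  exact @induced_eq_of_norm_eq K (Kn n) _ (spectralNorm.seminormedAddCommGroup ℚ_[p] K)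
    (spectralNorm.seminormedAddCommGroup ℚ_[p] (Kn n)) _ _ (algebraMap (Kn n) K)
    fun x => (spectralNorm.eq_of_tower x).symm

end Padic

/-- The dual of the unit ball for the character `z ↦ χ (a * Tr z)` is determined by the
trace pairing. -/
theorem unitBallDual_trace_eq {k L : Type} [Field k] [NormedField L] [Algebra k L]
    {χ : k → ℂ} {A : k → ℝ} {E : ℕ} (hE : E ≠ 0) (hA : ∀ c, A c = ‖algebraMap k L c‖ ^ E)
    (htriv : ∀ x, A x ≤ 1 → χ x = 1) (hrank : ∀ w, 1 < A w → ∃ x, A x ≤ A w ∧ χ x ≠ 1) (a : k) :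
    unitBallDual (fun z : L => χ (a * Algebra.trace k L z)) =
      {z | ∀ y : L, ‖y‖ ≤ 1 → A (Algebra.trace k L (a • z * y)) ≤ 1} := by
  have htr : ∀ z y : L, a * Algebra.trace k L (y * z) = Algebra.trace k L (a • z * y) := by
    intro z y
    rw [smul_mul_assoc, map_smul, smul_eq_mul, mul_comm z y]
  ext z
  constructor
  · intro hz y hy
    by_contra! hlt
    obtain ⟨x, hx, hne⟩ := hrank _ hlt
    set w := Algebra.trace k L (a • z * y) with hw
    rw [hA, hA, pow_le_pow_iff_left₀ (norm_nonneg _) (norm_nonneg _) hE] at hx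
    have hw0 : w ≠ 0 := by
      intro h
      rw [h, hA] at hlt
      simp only [map_zero, norm_zero, zero_pow hE] at hlt
      exact absurd hlt (by norm_num)
    have hpos : 0 < ‖algebraMap k L w‖ := by simpa using hw0
    have h1 := hz ((x / w) • y) (by
      rw [Algebra.smul_def, norm_mul, map_div₀, norm_div]
      exact mul_le_one₀ ((div_le_one hpos).mpr hx) (norm_nonneg _) hy)
    refine hne ?_
    have h2 : a * Algebra.trace k L ((x / w) • y * z) = x := by
      rw [smul_mul_assoc, map_smul, smul_eq_mul, mul_left_comm, htr, ← hw, div_mul_cancel₀ _ hw0]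
    simpa only [h2] using h1
  · intro hz y hy
    exact htriv _ (by rw [htr]; exact hz y hy)


theorem isUnitaryChar_trace (p : ℕ) [Fact (Nat.Prime p)] {k L : Type} [NormedField k]
    [NormedAlgebra ℚ_[p] k] [NormedField L] [NormedAlgebra ℚ_[p] L] [FiniteDimensional ℚ_[p] L]
    [Algebra k L] [IsScalarTower ℚ_[p] k L] {χ : k → ℂ} (hadd : ∀ x y, χ (x + y) = χ x * χ y)
    (hnorm : ∀ x, ‖χ x‖ = 1) (hcont : Continuous χ) (a : k) :
    IsUnitaryChar (fun z : L => χ (a * Algebra.trace k L z)) where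
  map_add x y := by rw [← hadd, map_add, mul_add]
  norm_eq_one x := hnorm _
  continuous := hcont.comp (continuous_mul_trace (p := p) a)

theorem isBounded_setOf_norm_mul_pow_le {L : Type} [NormedField L] {c : L} (hc : c ≠ 0) {E m : ℕ}
    (hE : E ≠ 0) (hm : m ≠ 0) (Q : ℝ) :
    Bornology.IsBounded {z : L | (‖c * z‖ ^ E) ^ m ≤ Q} := by
  refine (Metric.isBounded_iff_subset_closedBall 0).mpr ⟨max 1 Q / ‖c‖, fun z hz => ?_⟩
  have hz' : ‖c * z‖ ^ (E * m) ≤ Q := by rw [pow_mul]; exact hz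
  rw [mem_closedBall_zero_iff, le_div_iff₀ (norm_pos_iff.mpr hc), mul_comm, ← norm_mul]
  rcases le_total ‖c * z‖ 1 with h | h
  · exact h.trans (le_max_left _ _)
  · exact ((le_self_pow₀ h (mul_ne_zero hE hm)).trans hz').trans (le_max_right _ _)

theorem setOf_norm_mul_pow_le_mem_nhds {L : Type} [NormedField L] (c : L) {E m : ℕ}
    (hE : E ≠ 0) (hm : m ≠ 0) {Q : ℝ} (hQ : 0 < Q) :
    {z : L | (‖c * z‖ ^ E) ^ m ≤ Q} ∈ nhds (0 : L) := by
  have hcont : Continuous fun z : L => (‖c * z‖ ^ E) ^ m := by fun_prop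
  have h0 : (‖c * 0‖ ^ E) ^ m < Q := by simpa [hE, hm] using hQ
  filter_upwards [hcont.continuousAt.eventually (gt_mem_nhds h0)] with z hz using hz.le

theorem statement_19
    (p : ℕ) [Fact (Nat.Prime p)]
    (k : Type) [Field k] [Algebra ℚ_[p] k] [FiniteDimensional ℚ_[p] k]
    (K : Type) [Field K] [Algebra k K] [CharZero K]
    (Kn : ℕ → IntermediateField k K)
    (hbot : Kn 1 = ⊥) (hmono : Monotone Kn)
    [hfd : ∀ n, FiniteDimensional k (Kn n)]
    (hunion : ∀ x : K, ∃ n, x ∈ Kn n)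
    (T : ℕ → K →ₗ[k] K)
    (hTmem : ∀ (n : ℕ) (x : K), T n x ∈ Kn n)
    (hTdef : ∀ (n ν : ℕ) (h : n ≤ ν) (x : K) (hx : x ∈ Kn ν),
      T n x = ((finrank k (Kn n) : K) / (finrank k (Kn ν) : K)) *
        (relTrace k K (Kn n) (Kn ν) (hmono h) ⟨x, hx⟩ : K))
    (Knorm : K → ℝ)
    (hKnorm : ∀ (n : ℕ) (x : K) (hx : x ∈ Kn n),
      Knorm x = absk p k (Algebra.norm k (⟨x, hx⟩ : Kn n)) ^ ((finrank k (Kn n) : ℝ)⁻¹))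
    (pairing : K → ProjLim k K Kn T → k)
    (hpair : ∀ (n : ℕ) (a : K) (ha : a ∈ Kn n) (x : ProjLim k K Kn T),
      pairing a x = (finrank k (Kn n) : k)⁻¹ *
        Algebra.trace k (Kn n) (⟨a * x.1 n, mul_mem ha (x.2.1 n)⟩ : Kn n))
    (q : ℕ → ℕ)
    (hq : ∀ n : ℕ, IsGreatest
      {r : ℝ | (∃ x : Kn n, Knorm ↑x ^ (finrank k (Kn n) : ℝ) = r) ∧ r < 1} ((q n : ℝ)⁻¹))
    (χ : k → ℂ)
    (hχadd : ∀ x y : k, χ (x + y) = χ x * χ y)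
    (hχnorm : ∀ x : k, ‖χ x‖ = 1)
    (hχcont : @Continuous _ _ (kTop p k) _ χ)
    (hχtriv : ∀ x : k, absk p k x ≤ 1 → χ x = 1)
    (hχrank : ∃ x : k, absk p k x ≤ (q 1 : ℝ) ∧ χ x ≠ 1)
    (d : ℕ → ℕ)
    (hd : ∀ (n : ℕ) (x : Kn n),
      Knorm ↑x ^ (finrank k (Kn n) : ℝ) ≤ (q n : ℝ) ^ (d n : ℝ) ↔
        ∀ y : Kn n, Knorm ↑y ≤ 1 → absk p k (Algebra.trace k (Kn n) (x * y)) ≤ 1)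
    (vol : ∀ n : ℕ, @MeasureTheory.Measure (Kn n) (KnMeas k K Kn Knorm n))
    (hvolinv : ∀ (n : ℕ) (a : Kn n) (A : Set (Kn n)),
      MeasurableSet[KnMeas k K Kn Knorm n] A → vol n ((fun z => a + z) ⁻¹' A) = vol n A)
    (hvolnorm : ∀ n : ℕ, vol n {z : Kn n | Knorm ↑z ≤ 1} = 1)
    (μ : @MeasureTheory.Measure (ProjLim k K Kn T) (projMeas k K Kn T Knorm))
    (hμprob : MeasureTheory.IsProbabilityMeasure μ)
    (hμradon : ∀ A : Set (ProjLim k K Kn T), MeasurableSet[projMeas k K Kn T Knorm] A →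
      μ A = ⨆ (C : Set (ProjLim k K Kn T))
        (_ : C ⊆ A ∧ @IsCompact _ (projTop k K Kn T Knorm) C), μ C)
    (hμchar : ∀ a : K, ∫ x, χ (pairing a x) ∂μ = if Knorm a ≤ 1 then (1 : ℂ) else 0)
    (α : ℝ) (hα : 0 < α)
    (π : ℝ → @MeasureTheory.Measure (ProjLim k K Kn T) (projMeas k K Kn T Knorm))
    (hπprob : ∀ t : ℝ, 0 < t → MeasureTheory.IsProbabilityMeasure (π t))
    (hπchar : ∀ t : ℝ, 0 < t → ∀ ξ : K,
      ∫ x, χ (pairing ξ x) ∂(π t) =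
        (((if Knorm ξ ≤ 1 then (1 : ℝ) else Real.exp (-t * Knorm ξ ^ α)) : ℝ) : ℂ))
    (n : ℕ) (hn : 1 ≤ n) (φ : Kn n → ℂ)
    (hφ : @IsLocallyConstant _ _ (KnTop k K Kn Knorm n) φ) :
    (∀ t : ℝ, 0 < t →
      ∃ ψ : Kn n → ℂ, @IsLocallyConstant _ _ (KnTop k K Kn Knorm n) ψ ∧
        ∀ x : ProjLim k K Kn T,
          (∫ y, φ ⟨(pladd k K Kn T x y).1 n, (pladd k K Kn T x y).2.1 n⟩ ∂(π t))
            = ψ ⟨x.1 n, x.2.1 n⟩) ∧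
    (∀ x ∈ {x : ProjLim k K Kn T | ∀ m : ℕ, 1 ≤ m →
        Knorm (x.1 m) ≤ (q m : ℝ) ^ ((d m : ℝ) / (finrank k (Kn m) : ℝ)) *
          absk p k (finrank k (Kn m) : k)},
      ∀ t : ℝ, 0 < t →
        HasDerivAt
          (fun s : ℝ =>
            ∫ y, φ ⟨(pladd k K Kn T x y).1 n, (pladd k K Kn T x y).2.1 n⟩ ∂(π s))
          (-(Dop k K Kn T Knorm χ pairing vol μ α n
              (fun z : Kn n => ∫ y, φ (z + ⟨y.1 n, y.2.1 n⟩) ∂(π t)) x)) t) ∧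
    (∀ x ∈ {x : ProjLim k K Kn T | ∀ m : ℕ, 1 ≤ m →
        Knorm (x.1 m) ≤ (q m : ℝ) ^ ((d m : ℝ) / (finrank k (Kn m) : ℝ)) *
          absk p k (finrank k (Kn m) : k)},
      Filter.Tendsto
        (fun t : ℝ =>
          ∫ y, φ ⟨(pladd k K Kn T x y).1 n, (pladd k K Kn T x y).2.1 n⟩ ∂(π t))
        (nhdsWithin 0 (Set.Ioi 0)) (nhds (φ ⟨x.1 n, x.2.1 n⟩))) := by
  let : Algebra ℚ_[p] K := ((algebraMap k K).comp (algebraMap ℚ_[p] k)).toAlgebra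
  have hkK : IsScalarTower ℚ_[p] k K := .of_algebraMap_eq fun _ => rfl
  have hKnK : ∀ m, IsScalarTower ℚ_[p] (Kn m) K := isScalarTower_padic Kn
  have hfdp : ∀ m, FiniteDimensional ℚ_[p] (Kn m) := fun m => FiniteDimensional.trans ℚ_[p] k (Kn m)
  have halg : Algebra.IsAlgebraic ℚ_[p] K := ⟨fun x => by
    obtain ⟨m, hx⟩ := hunion x
    exact (Algebra.IsAlgebraic.isAlgebraic (R := ℚ_[p]) (⟨x, hx⟩ : Kn m)).algebraMap (A := K)⟩
  set E := finrank ℚ_[p] k with hEdef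
  have hE : E ≠ 0 := finrank_pos.ne'
  have hKn : ∀ (m : ℕ) (z : Kn m), Knorm z = spectralNorm ℚ_[p] (Kn m) z ^ E := fun m z => by
    rw [hKnorm m z z.2, ← absk_norm_rpow_eq_spectralNorm_pow]
  have hK : ∀ x, Knorm x = spectralNorm ℚ_[p] K x ^ E := fun x => by
    obtain ⟨m, hx⟩ := hunion x
    rw [hKn m ⟨x, hx⟩, spectralNorm.eq_of_tower (L := K)]
    rfl
  have hkK' : ∀ c : k, absk p k c = Knorm (algebraMap k K c) := fun c => by
    rw [absk_eq_spectralNorm_pow, hK, spectralNorm.eq_of_tower (L := K)]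
  have hqpos : ∀ m, 0 < (q m : ℝ) := fun m => by
    obtain ⟨c, hc0, hc1⟩ := NormedField.exists_norm_lt_one ℚ_[p]
    have hc : Knorm (algebraMap ℚ_[p] (Kn m) c) = ‖c‖ ^ E := by
      rw [hKn, spectralNorm_extends]
    refine inv_pos.mp (lt_of_lt_of_le ?_ ((hq m).2 ⟨⟨algebraMap ℚ_[p] (Kn m) c, rfl⟩, ?_⟩))
    · rw [hc]
      positivity
    · rw [hc, Real.rpow_natCast]
      exact pow_lt_one₀ (by positivity) (pow_lt_one₀ hc0.le hc1 hE) finrank_pos.ne'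
  have hrank : ∀ w, 1 < absk p k w → ∃ x, absk p k x ≤ absk p k w ∧ χ x ≠ 1 := fun w hw => by
    obtain ⟨x, hx, hne⟩ := hχrank
    have hone : finrank k (Kn 1) = 1 := by rw [hbot]; exact IntermediateField.finrank_bot
    have hinv : Knorm (algebraMap k (Kn 1) w⁻¹) = (absk p k w)⁻¹ :=
      (hkK' w⁻¹).symm.trans (absk_inv w)
    have hle : (absk p k w)⁻¹ ≤ (q 1 : ℝ)⁻¹ := by
      refine (hq 1).2 ⟨⟨algebraMap k (Kn 1) w⁻¹, ?_⟩, inv_lt_one_of_one_lt₀ hw⟩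
      rw [hinv, hone, Nat.cast_one, Real.rpow_one]
    exact ⟨x, hx.trans ((inv_le_inv₀ (one_pos.trans hw) (hqpos 1)).mp hle), hne⟩
  have htop := KnTop_eq_spectralNorm hK Kn n
  let : NontriviallyNormedField (Kn n) := spectralNorm.nontriviallyNormedField ℚ_[p] (Kn n)
  let : NormedAlgebra ℚ_[p] (Kn n) := spectralNorm.normedAlgebra ℚ_[p] (Kn n)
  let : NontriviallyNormedField k := spectralNorm.nontriviallyNormedField ℚ_[p] k
  let : NormedAlgebra ℚ_[p] k := spectralNorm.normedAlgebra ℚ_[p] k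
  have hultra : IsUltrametricDist (Kn n) :=
    IsUltrametricDist.isUltrametricDist_of_isNonarchimedean_norm isNonarchimedean_spectralNorm
  have hproper : ProperSpace (Kn n) := FiniteDimensional.proper ℚ_[p] (Kn n)
  let mL : MeasurableSpace (Kn n) := KnMeas k K Kn Knorm n
  have hborel : BorelSpace (Kn n) := ⟨by rw [← htop]; rfl⟩
  let mP : MeasurableSpace (ProjLim k K Kn T) := projMeas k K Kn T Knorm
  have hN : ∀ z : Kn n, Knorm z = ‖z‖ ^ E := hKn n
  have hN1 : ∀ ξ : Kn n, Knorm ξ ≤ 1 ↔ ‖ξ‖ ≤ 1 := fun ξ => by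
    rw [hN, pow_le_one_iff_of_nonneg (norm_nonneg _) hE]
  have hkn : ∀ c : k, absk p k c = ‖c‖ ^ E := fun c => absk_eq_spectralNorm_pow c
  have hχ : Continuous χ := by
    rw [kTop, normTopology_eq_of_norm_pow hE hkn] at hχcont
    exact hχcont
  set m := finrank k (Kn n) with hm
  have hm0 : m ≠ 0 := finrank_pos.ne'
  set a : k := (m : k)⁻¹ with ha
  have he := isUnitaryChar_trace p (L := Kn n) hχadd hχnorm hχ a
  set e : Kn n → ℂ := fun z => χ (a * Algebra.trace k (Kn n) z) with hedef
  set Y : ProjLim k K Kn T → Kn n := fun y => ⟨y.1 n, y.2.1 n⟩ with hYdef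
  have hY : Measurable Y := by
    let tP : TopologicalSpace (ProjLim k K Kn T) := projTop k K Kn T Knorm
    have hP : BorelSpace (ProjLim k K Kn T) := ⟨rfl⟩
    have hcont : Continuous Y := continuous_of_isOpen_norm_pow_lt hE hN fun x ε hε =>
      TopologicalSpace.isOpen_generateFrom_of_mem ⟨x, n, ε, hε, rfl⟩
    exact hcont.measurable
  have hpairY : ∀ (ξ : Kn n) y, χ (pairing ξ y) = e (ξ * Y y) := fun ξ y => by
    rw [hpair n ξ ξ.2 y]; rfl
  have hchar : CharZero k := charZero_of_injective_algebraMap (algebraMap ℚ_[p] k).injective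
  have ha0 : a ≠ 0 := inv_ne_zero (Nat.cast_ne_zero.mpr hm0)
  have hA : ∀ c, absk p k c = ‖algebraMap k (Kn n) c‖ ^ E := fun c =>
    (hkK' c).trans (hN (algebraMap k (Kn n) c))
  have hdual : unitBallDual e = {z | (‖algebraMap k (Kn n) a * z‖ ^ E) ^ m ≤ (q n : ℝ) ^ d n} := by
    rw [unitBallDual_trace_eq hE hA hχtriv hrank a]
    ext z
    simp only [Set.mem_ofPred_eq, ← hN1]
    rw [← hd n (a • z), hN, Algebra.smul_def, Real.rpow_natCast, Real.rpow_natCast]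
  have hbdd : Bornology.IsBounded (unitBallDual e) := by
    rw [hdual]
    exact isBounded_setOf_norm_mul_pow_le (by simpa using ha0) hE hm0 _
  have hnhds : unitBallDual e ∈ nhds 0 := by
    rw [hdual]
    exact setOf_norm_mul_pow_le_mem_nhds _ hE hm0 (pow_pos (hqpos n) _)
  have hxdual : ∀ x ∈ {x : ProjLim k K Kn T | ∀ m : ℕ, 1 ≤ m →
        Knorm (x.1 m) ≤ (q m : ℝ) ^ ((d m : ℝ) / (finrank k (Kn m) : ℝ)) *
          absk p k (finrank k (Kn m) : k)}, Y x ∈ unitBallDual e := by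
    intro x hx
    have hpos : 0 < absk p k (m : k) := by
      rw [hkn]
      exact pow_pos (norm_pos_iff.mpr (Nat.cast_ne_zero.mpr hm0)) _
    have hle : ‖algebraMap k (Kn n) a * Y x‖ ^ E ≤ (q n : ℝ) ^ ((d n : ℝ) / m) := by
      rw [norm_mul, mul_pow, ← hA, ← hN, ha, absk_inv]
      exact (inv_mul_le_iff₀ hpos).mpr ((hx n hn).trans_eq (mul_comm _ _))
    rw [hdual]
    refine (pow_le_pow_left₀ (by positivity) hle m).trans_eq ?_
    rw [← Real.rpow_natCast, ← Real.rpow_mul (hqpos n).le,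
      div_mul_cancel₀ _ (Nat.cast_ne_zero.mpr hm0), Real.rpow_natCast]
  have hNcongr : ∀ ξ η : Kn n, ‖ξ‖ = ‖η‖ → Knorm ξ = Knorm η := fun ξ η h => by rw [hN, hN, h]
  have hμe : ∀ ξ : Kn n, ∫ y, e (ξ * Y y) ∂μ = if Knorm ξ ≤ 1 then (1 : ℂ) else 0 := fun ξ => by
    simp only [← hpairY, hμchar]
  have hπe : ∀ t : ℝ, 0 < t → ∀ ξ : Kn n, ∫ y, e (ξ * Y y) ∂(π t) =
      (((if Knorm ξ ≤ 1 then (1 : ℝ) else Real.exp (-t * Knorm ξ ^ α)) : ℝ) : ℂ) :=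
    fun t ht ξ => by simp only [← hpairY, hπchar t ht]
  rw [htop] at hφ ⊢
  refine ⟨fun t ht => ⟨fun z => ∫ y, φ (z + Y y) ∂(π t), ?_, fun x => rfl⟩, fun x hx t ht => ?_,
    fun x hx => ?_⟩
  · have := hπprob t ht
    refine he.isLocallyConstant_integral_shift hbdd (π t)
      (he.ae_mem_dual hY (π t) fun ξ hξ => ?_) hφ
    rw [hπe t ht, if_pos ((hN1 ξ).mpr hξ), Complex.ofReal_one]
  · have hder := he.hasDerivAt_integral_shift hY hbdd hnhds hN1 hNcongr (hvolinv n) (hvolnorm n)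
      hμe hπprob hπe hφ (hxdual x hx) ht
    have hDop : Dop k K Kn T Knorm χ pairing vol μ α n
        (fun z : Kn n => ∫ y, φ (z + ⟨y.1 n, y.2.1 n⟩) ∂(π t)) x =
        ∫ ξ, e (-(Y x * ξ)) * (if 1 < Knorm ξ then ((Knorm ξ ^ α : ℝ) : ℂ) else 0) *
          (∫ y, e (ξ * Y y) * (∫ y', φ (Y y + Y y') ∂(π t)) ∂μ) ∂(vol n) := by
      simp only [← hpairY]
      rfl
    rw [hDop]
    exact hder
  · exact he.tendsto_integral_shift hY hbdd hnhds hN1 hπprob hπe hφ (hxdual x hx)
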